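/- Under the standing curve hypotheses, for every j∈ℕ and every t∈[2,8] one has C₂(t)>0, C₂'(t)>0, C₂''(t)>0, C₃⁻(t)>0, (C₃⁻)'(t)>0, (C₃⁻)''(t)>0, and C₂(t) ≤ 7·C₂'(t). -/

import Mathlib

open MeasureTheory Real Set
open scoped ENNReal NNReal

noncomputable section

/-- The underlying space of the Heisenberg group `H¹ ≅ ℝ³`. -/
abbrev H3 : Type := Fin 3 → ℝ

/-- Heisenberg group multiplication. -/
def hmul (x y : H3) : H3 :=
  ![x 0 + y 0, x 1 + y 1, x 2 + y 2 + (1/2) * (x 0 * y 1 - x 1 * y 0)]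

/-- Heisenberg group inverse. -/
def hinv (x : H3) : H3 := -x

/-- Second derivative. -/
def d2 (f : ℝ → ℝ) : ℝ → ℝ := deriv (deriv f)

/-- Third derivative. -/
def d3 (f : ℝ → ℝ) : ℝ → ℝ := deriv (deriv (deriv f))

/-- `h₂(t) = t α'(t) - α(t)`. -/
def h₂ (α : ℝ → ℝ) (t : ℝ) : ℝ := t * deriv α t - α t

/-- `β̄(t) = β(t) - (1/2)∫₀ᵗ h₂`. -/
def βbar (α β : ℝ → ℝ) (t : ℝ) : ℝ := β t - (1/2) * ∫ s in (0:ℝ)..t, h₂ α s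

/-- `h̄₃(t) = det [[t,α,β̄],[1,α',β̄'],[0,α'',β̄'']] / α''(t)`. -/
def hbar₃ (α β : ℝ → ℝ) (t : ℝ) : ℝ :=
  Matrix.det !![t, α t, βbar α β t;
                1, deriv α t, deriv (βbar α β) t;
                0, d2 α t, d2 (βbar α β) t] / d2 α t

/-- `h̄_β(t) = t β̄'(t) - β̄(t)`. -/
def hβbar (α β : ℝ → ℝ) (t : ℝ) : ℝ := t * deriv (βbar α β) t - βbar α β t

/-- The standing curve hypotheses of the paper. -/
structure Standing (α β : ℝ → ℝ) : Prop where
  alpha_odd : ∀ t, α (-t) = -α t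
  beta_odd : ∀ t, β (-t) = -β t
  alpha_cont : Continuous α
  beta_cont : Continuous β
  alpha_c3 : ContDiffOn ℝ 3 α (Set.Ioi 0)
  beta_c3 : ContDiffOn ℝ 3 β (Set.Ioi 0)
  alpha_deriv0 : deriv α 0 = 0
  d2α_pos : ∀ t, 0 < t → 0 < d2 α t
  Dbar3_pos : ∀ t, 0 < t →
    0 < d2 α t * d3 (βbar α β) t - d3 α t * d2 (βbar α β) t
  Dhat3_pos : ∀ t, 0 < t →
    0 < d2 α t * (d3 (βbar α β) t + 2 * d2 α t) - d3 α t * (d2 (βbar α β) t + deriv α t)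
  Ddoublehat3_pos : ∀ t, 0 < t →
    0 < d2 α t * (d3 (βbar α β) t - d2 α t) - d3 α t * (d2 (βbar α β) t - deriv α t)
  Dtriplehat3_pos : ∀ t, 0 < t →
    0 < d2 α t * (d3 (βbar α β) t - d2 α t) - d3 α t * (d2 (βbar α β) t - deriv α t + α t / t)
  growth : ∃ c, 0 < c ∧ ∀ t, 0 < t →
    c * (h₂ α t / t) ≤ deriv (h₂ α) t ∧
    c * (hbar₃ α β t / t) ≤ deriv (hbar₃ α β) t ∧
    c * (∫ s in (0:ℝ)..t, h₂ α s) ≤ hbar₃ α β t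
/-- The matrix `Ã(t)`. -/
def Atil (α β : ℝ → ℝ) (t : ℝ) : Matrix (Fin 3) (Fin 3) ℝ :=
  !![t, 0, 0;
     α t, h₂ α t, 0;
     βbar α β t, hβbar α β t, t * h₂ α t + hbar₃ α β t]

/-- `t_j = 2^{-j}`. -/
def tj (j : ℕ) : ℝ := ((2:ℝ) ^ j)⁻¹

/-- `S_j = det Ã_j`. -/
def Sdet (α β : ℝ → ℝ) (j : ℕ) : ℝ := (Atil α β (tj j)).det

/-- `ξ_t = (1/2) t h₂(t) / (t h₂(t) + h̄₃(t))`. -/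
def ξc (α β : ℝ → ℝ) (t : ℝ) : ℝ := (1/2) * (t * h₂ α t) / (t * h₂ α t + hbar₃ α β t)

/-- `ξ_j`. -/
def ξj (α β : ℝ → ℝ) (j : ℕ) : ℝ := ξc α β (tj j)

/-- Frobenius norm of a `3 × 3` real matrix. -/
def frob (M : Matrix (Fin 3) (Fin 3) ℝ) : ℝ := Real.sqrt (∑ i, ∑ k, (M i k) ^ 2)
/-- `C₂(t) = (α(2^{-j}t) - t α(2^{-j})) / h₂(2^{-j})`. -/
def C2f (α : ℝ → ℝ) (j : ℕ) (t : ℝ) : ℝ := (α (tj j * t) - t * α (tj j)) / h₂ α (tj j)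

/-- `C₃(t)`. -/
def C3f (α β : ℝ → ℝ) (j : ℕ) (t : ℝ) : ℝ :=
  (β (tj j * t) - t * βbar α β (tj j)
    - (α (tj j * t) - t * α (tj j)) * hβbar α β (tj j) / h₂ α (tj j))
  / (tj j * h₂ α (tj j) + hbar₃ α β (tj j))

/-- `C₃⁻(t)`: the expression of `C₃(t)` with `β̄(2^{-j}t)` in place of `β(2^{-j}t)`. -/
def C3m (α β : ℝ → ℝ) (j : ℕ) (t : ℝ) : ℝ :=
  (βbar α β (tj j * t) - t * βbar α β (tj j)
    - (α (tj j * t) - t * α (tj j)) * hβbar α β (tj j) / h₂ α (tj j))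
  / (tj j * h₂ α (tj j) + hbar₃ α β (tj j))

/-- `Ĉ₃(t) = C₃(t) + ξ_j t C₂(t)`. -/
def C3hat (α β : ℝ → ℝ) (j : ℕ) (t : ℝ) : ℝ := C3f α β j t + ξj α β j * t * C2f α j t

/-- `Č₃(t) = C₃(t) − ξ_j t C₂(t)`. -/
def C3check (α β : ℝ → ℝ) (j : ℕ) (t : ℝ) : ℝ := C3f α β j t - ξj α β j * t * C2f α j t

theorem aux_diff (f : ℝ → ℝ) (hf : ContDiffOn ℝ 3 f (Set.Ioi 0)) :
    (∀ t, 0 < t → DifferentiableAt ℝ f t) ∧ (∀ t, 0 < t → DifferentiableAt ℝ (deriv f) t) ∧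
    (∀ t, 0 < t → DifferentiableAt ℝ (deriv (deriv f)) t) ∧
    ContDiffOn ℝ 2 (deriv f) (Set.Ioi 0) := by
  have h1 := (contDiffOn_succ_iff_deriv_of_isOpen (n := 2) isOpen_Ioi).1 (by norm_num; exact hf)
  have h2 := (contDiffOn_succ_iff_deriv_of_isOpen (n := 1) isOpen_Ioi).1
    (by norm_num; exact h1.2.2)
  have h3 := h2.2.2.differentiableOn (by norm_num)
  exact ⟨fun t ht => h1.1.differentiableAt (isOpen_Ioi.mem_nhds ht),
    fun t ht => h2.1.differentiableAt (isOpen_Ioi.mem_nhds ht),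
    fun t ht => h3.differentiableAt (isOpen_Ioi.mem_nhds ht), h1.2.2⟩

/-- Main convexity lemma, applied to both functions. -/
theorem aux_main (f G : ℝ → ℝ) (a D : ℝ) (ha : 0 < a) (hD : 0 < D)
    (hG : ∀ t, G t = (f (a * t) - t * f a) / D)
    (h1 : ∀ t, 0 < t → DifferentiableAt ℝ f t)
    (h2 : ∀ t, 0 < t → DifferentiableAt ℝ (deriv f) t)
    (hpos : ∀ t, a < t → 0 < deriv (deriv f) t)
    (h0 : 0 ≤ a * deriv f a - f a) (t : ℝ) (ht : 1 < t) :
    0 < G t ∧ 0 < deriv G t ∧ 0 < d2 G t ∧ G t ≤ (t - 1) * deriv G t := by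
  have hGe : G = fun t => (f (a * t) - t * f a) / D := funext hG
  have hlin : ∀ s : ℝ, HasDerivAt (fun t => a * t) a s := fun s => by
    simpa using (hasDerivAt_id s).const_mul a
  have hd1 : ∀ s, 0 < s → HasDerivAt G ((a * deriv f (a * s) - f a) / D) s := by
    intro s hs
    rw [hGe]
    have e := (h1 (a * s) (by positivity)).hasDerivAt.comp s (hlin s)
    have e2 := (e.sub ((hasDerivAt_id s).mul_const (f a))).div_const D
    exact e2.congr_deriv (by ring)
  have hev : deriv G =ᶠ[nhds t] fun s => (a * deriv f (a * s) - f a) / D := by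
    filter_upwards [isOpen_Ioi.mem_nhds (show t ∈ Set.Ioi (0:ℝ) by simp; linarith)] with s hs
    exact (hd1 s hs).deriv
  have hd2 : d2 G t = a ^ 2 * deriv (deriv f) (a * t) / D := by
    have e := (h2 (a * t) (by nlinarith)).hasDerivAt.comp t (hlin t)
    have e2 := ((e.const_mul a).sub_const (f a)).div_const D
    unfold d2
    rw [hev.deriv_eq]
    refine HasDerivAt.deriv ?_
    exact e2.congr_deriv (by ring)
  have hat : ∀ s, 1 < s → a < a * s := fun s hs => by nlinarith
  have hmono : StrictMonoOn (deriv f) (Set.Ici a) := by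
    apply strictMonoOn_of_deriv_pos (convex_Ici a)
    · intro x hx
      exact (h2 x (lt_of_lt_of_le ha hx)).continuousAt.continuousWithinAt
    · intro x hx
      rw [interior_Ici] at hx
      exact hpos x hx
  have hGderpos : ∀ s, 1 < s → 0 < deriv G s := by
    intro s hs
    rw [(hd1 s (by linarith)).deriv]
    have := hmono (Set.self_mem_Ici) (le_of_lt (hat s hs)) (hat s hs)
    apply div_pos _ hD
    nlinarith
  obtain ⟨c, hc, hceq⟩ := exists_hasDerivAt_eq_slope G (deriv G) ht
    (fun x hx => (hd1 x (by linarith [hx.1])).continuousAt.continuousWithinAt)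
    (fun x hx => (hd1 x (by linarith [hx.1])).differentiableAt.hasDerivAt)
  have hG1 : G 1 = 0 := by rw [hG]; simp
  have hGt : G t = (t - 1) * deriv G c := by
    rw [hceq, hG1]
    field_simp [show t - 1 ≠ 0 by linarith]
    ring
  refine ⟨?_, hGderpos t ht, ?_, ?_⟩
  · rw [hGt]
    exact mul_pos (by linarith) (hGderpos c hc.1)
  · rw [hd2]
    have := hpos (a * t) (hat t ht)
    positivity
  · rw [hGt]
    apply mul_le_mul_of_nonneg_left _ (by linarith)
    rw [(hd1 c (by linarith [hc.1])).deriv, (hd1 t (by linarith)).deriv]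
    have := hmono (le_of_lt (hat c hc.1)) (le_of_lt (hat t ht)) (by nlinarith [hc.2])
    apply div_le_div_of_nonneg_right _ hD.le
    nlinarith

theorem aux_h2_pos (α β : ℝ → ℝ) (hst : Standing α β) (a : ℝ) (ha : 0 < a) : 0 < h₂ α a := by
  obtain ⟨d1, dd2, -, -⟩ := aux_diff α hst.alpha_c3
  have h0 : α 0 = 0 := by have := hst.alpha_odd 0; simp at this; linarith
  have hmono : StrictMonoOn (deriv α) (Set.Ioi 0) := by
    apply strictMonoOn_of_deriv_pos (convex_Ioi 0)
    · intro x hx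
      exact (dd2 x hx).continuousAt.continuousWithinAt
    · intro x hx
      rw [interior_Ioi] at hx
      exact hst.d2α_pos x hx
  obtain ⟨c, hc, hceq⟩ := exists_hasDerivAt_eq_slope α (deriv α) ha
    hst.alpha_cont.continuousOn
    (fun x hx => (d1 x hx.1).hasDerivAt)
  have := hmono hc.1 ha hc.2
  rw [hceq, h0, sub_zero, sub_zero, div_lt_iff₀ ha] at this
  unfold h₂
  linarith

theorem aux_bbar (α β : ℝ → ℝ) (hst : Standing α β) :
    ContDiffOn ℝ 3 (βbar α β) (Set.Ioi 0) := by
  obtain ⟨d1, dd2, -, c2⟩ := aux_diff α hst.alpha_c3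
  obtain ⟨b1, -, -, bc2⟩ := aux_diff β hst.beta_c3
  have h0 : α 0 = 0 := by have := hst.alpha_odd 0; simp at this; linarith
  have hderiv : ∀ x, 0 < x → HasDerivAt (h₂ α) (x * deriv (deriv α) x) x := by
    intro x hx
    have e := ((hasDerivAt_id x).mul (dd2 x hx).hasDerivAt).sub (d1 x hx).hasDerivAt
    exact e.congr_deriv (by simp)
  have hmono : StrictMonoOn (h₂ α) (Set.Ioi 0) := by
    apply strictMonoOn_of_deriv_pos (convex_Ioi 0)
    · intro x hx
      exact (hderiv x hx).continuousAt.continuousWithinAt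
    · intro x hx
      rw [interior_Ioi] at hx
      rw [(hderiv x hx).deriv]
      exact mul_pos hx (hst.d2α_pos x hx)
  have hmono2 : MonotoneOn (h₂ α) (Set.Ici 0) := by
    intro x hx y hy hxy
    rcases eq_or_lt_of_le (show (0:ℝ) ≤ x from hx) with h | h
    · subst h
      have e : h₂ α 0 = 0 := by simp [h₂, h0]
      rw [e]
      rcases eq_or_lt_of_le hxy with hxy2 | hxy2
      · rw [← hxy2, e]
      · exact (aux_h2_pos α β hst y hxy2).le
    · exact hmono.monotoneOn h (lt_of_lt_of_le h hxy) hxy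
  have hcd : ContDiffOn ℝ 2 (h₂ α) (Set.Ioi 0) := by
    have : ContDiffOn ℝ 2 α (Set.Ioi 0) := hst.alpha_c3.of_le (by norm_num)
    exact (contDiffOn_id.mul c2).sub this
  have hbd : ∀ x, 0 < x → HasDerivAt (βbar α β) (deriv β x - (1/2) * h₂ α x) x := by
    intro x hx
    have hint : IntervalIntegrable (h₂ α) volume 0 x :=
      MonotoneOn.intervalIntegrable (hmono2.mono (by
        rw [Set.uIcc_of_le hx.le]; exact Set.Icc_subset_Ici_self))
    have hI := intervalIntegral.integral_hasDerivAt_right hint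
      (hcd.continuousOn.stronglyMeasurableAtFilter isOpen_Ioi x hx)
      (hderiv x hx).continuousAt
    exact (b1 x hx).hasDerivAt.sub (hI.const_mul (1/2))
  have : ContDiffOn ℝ (2 + 1) (βbar α β) (Set.Ioi 0) := by
    refine (contDiffOn_succ_iff_deriv_of_isOpen isOpen_Ioi).2 ⟨?_, by simp, ?_⟩
    · intro x hx
      exact (hbd x hx).differentiableAt.differentiableWithinAt
    · refine ContDiffOn.congr (bc2.sub (contDiffOn_const.mul hcd)) (fun x hx => (hbd x hx).deriv)
  norm_num at this
  exact this

/-- Positivity and monotonicity of `C₂` and `C₃⁻` on `[2,8]`,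
together with `C₂(t) ≤ 7 C₂'(t)`. -/
theorem C2_C3m_positivity
    (α β : ℝ → ℝ) (hst : Standing α β) :
    ∀ j : ℕ, ∀ t ∈ Set.Icc (2:ℝ) 8,
      0 < C2f α j t ∧ 0 < deriv (C2f α j) t ∧ 0 < d2 (C2f α j) t ∧
      0 < C3m α β j t ∧ 0 < deriv (C3m α β j) t ∧ 0 < d2 (C3m α β j) t ∧
      C2f α j t ≤ 7 * deriv (C2f α j) t := by
  intro j t ht
  have ha : 0 < tj j := by unfold tj; positivity
  generalize htj : tj j = a at ha
  obtain ⟨d1, dd2, dd3, -⟩ := aux_diff α hst.alpha_c3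
  obtain ⟨b1, bb2, bb3, -⟩ := aux_diff _ (aux_bbar α β hst)
  have hh := aux_h2_pos α β hst a ha
  have hA := aux_main α (C2f α j) a (h₂ α a) ha hh (fun t => by simp [C2f, htj]) d1 dd2
    (fun s hs => hst.d2α_pos s (ha.trans hs)) hh.le t (by linarith [ht.1])
  obtain ⟨c, hc, hgr⟩ := hst.growth
  have h3 : 0 ≤ hbar₃ α β a := by
    refine le_trans (mul_nonneg hc.le ?_) (hgr a ha).2.2
    refine intervalIntegral.integral_nonneg ha.le (fun s hs => ?_)
    rcases eq_or_lt_of_le hs.1 with h | h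
    · have h0 : α 0 = 0 := by have := hst.alpha_odd 0; simp at this; linarith
      rw [← h]; simp [h₂, h0]
    · exact (aux_h2_pos α β hst s h).le
  have hα := hst.d2α_pos a ha
  have hid : hbar₃ α β a = h₂ α a * (d2 (βbar α β) a / d2 α a) - hβbar α β a := by
    unfold hbar₃ h₂ hβbar
    rw [Matrix.det_fin_three]
    simp
    field_simp
    ring
  set K := hβbar α β a / h₂ α a with hK
  have hKh : K * h₂ α a = hβbar α β a := div_mul_cancel₀ _ hh.ne'
  have hKle : K ≤ d2 (βbar α β) a / d2 α a := by
    rw [hK, div_le_iff₀ hh]; nlinarith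
  have hratio : StrictMonoOn (fun s => d2 (βbar α β) s / d2 α s) (Set.Ioi 0) := by
    have hd : ∀ x, 0 < x → HasDerivAt (fun s => d2 (βbar α β) s / d2 α s)
        ((d3 (βbar α β) x * d2 α x - d2 (βbar α β) x * d3 α x) / d2 α x ^ 2) x := fun x hx =>
      (bb3 x hx).hasDerivAt.div (dd3 x hx).hasDerivAt (hst.d2α_pos x hx).ne'
    apply strictMonoOn_of_deriv_pos (convex_Ioi 0)
    · intro x hx
      exact (hd x hx).continuousAt.continuousWithinAt
    · intro x hx
      rw [interior_Ioi] at hx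
      rw [(hd x hx).deriv]
      have := hst.Dbar3_pos x hx
      have := hst.d2α_pos x hx
      apply div_pos _ (by positivity)
      linarith
  have hf1 : ∀ x, 0 < x → HasDerivAt (fun s => βbar α β s - K * α s)
      (deriv (βbar α β) x - K * deriv α x) x := fun x hx =>
    (b1 x hx).hasDerivAt.sub ((d1 x hx).hasDerivAt.const_mul K)
  have hf2 : ∀ x, 0 < x → HasDerivAt (deriv (fun s => βbar α β s - K * α s))
      (d2 (βbar α β) x - K * d2 α x) x := by
    intro x hx
    have e := (bb2 x hx).hasDerivAt.sub ((dd2 x hx).hasDerivAt.const_mul K)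
    refine HasDerivAt.congr_of_eventuallyEq e ?_
    filter_upwards [isOpen_Ioi.mem_nhds (show x ∈ Set.Ioi (0:ℝ) from hx)] with s hs
    exact (hf1 s hs).deriv
  have hB := aux_main (fun s => βbar α β s - K * α s) (C3m α β j) a
    (a * h₂ α a + hbar₃ α β a) ha (by positivity)
    (fun t => by
      simp only [C3m, htj]
      congr 1
      rw [mul_div_assoc, ← hK]
      ring)
    (fun x hx => (hf1 x hx).differentiableAt) (fun x hx => (hf2 x hx).differentiableAt)
    (fun s hs => by
      have hs0 := ha.trans hs
      rw [(hf2 s hs0).deriv]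
      have := hratio ha hs0 hs
      have h5 := lt_of_le_of_lt hKle this
      rw [lt_div_iff₀ (hst.d2α_pos s hs0)] at h5
      linarith)
    (by
      rw [(hf1 a ha).deriv]
      apply le_of_eq
      unfold hβbar h₂ at hKh
      linarith) t (by linarith [ht.1])
  refine ⟨hA.1, hA.2.1, hA.2.2.1, hB.1, hB.2.1, hB.2.2.1, hA.2.2.2.trans ?_⟩
  exact mul_le_mul_of_nonneg_right (by linarith [ht.2]) hA.2.1.le
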